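/- arXiv:2511.23015 — 3 statements merged into one kernel-verified Lean document; each statement's English description precedes it below -/
import Mathlib

section
/- Equivalence of the coupled discrete temperature subsystem with the scalar temperature wave equation: let Δt > 0, τ > 0, let d : ℤ × ℤ → ℝ be a cell function, T*, T : ℤ × ℤ → ℝ cell functions, and J*_x, J*_y, J_x, J_y : ℤ × ℤ → ℝ vertex functions. Then the following two systems are equivalent: (A) for all vertices p and k ∈ {x,y}, J_k(p) = J*_k(p) − Δt·(G_k T)(p) − (Δt/τ)·J_k(p), and for all cells c, d(c)·T(c) = d(c)·T*(c) − Δt·((D_x J_x)(c) + (D_y J_y)(c)); (B) for all cells c, (1 + Δt/τ)·d(c)·T(c) − Δt²·((D_x(G_x T))(c) + (D_y(G_y T))(c)) = (1 + Δt/τ)·d(c)·T*(c) − Δt·((D_x J*_x)(c) + (D_y J*_y)(c)), and for all vertices p and k ∈ {x,y}, J_k(p) = (τ/(τ + Δt))·(J*_k(p) − Δt·(G_k T)(p)). -/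
/-- Cell-to-vertex gradient in the x-direction on the staggered grid. -/
noncomputable def Gx (dx : ℝ) (φ : ℤ × ℤ → ℝ) : ℤ × ℤ → ℝ :=
  fun q => (φ (q.1, q.2) + φ (q.1, q.2 - 1) - φ (q.1 - 1, q.2) - φ (q.1 - 1, q.2 - 1)) / (2 * dx)

/-- Cell-to-vertex gradient in the y-direction on the staggered grid. -/
noncomputable def Gy (dy : ℝ) (φ : ℤ × ℤ → ℝ) : ℤ × ℤ → ℝ :=
  fun q => (φ (q.1, q.2) + φ (q.1 - 1, q.2) - φ (q.1, q.2 - 1) - φ (q.1 - 1, q.2 - 1)) / (2 * dy)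

/-- Vertex-to-cell gradient in the x-direction on the staggered grid. -/
noncomputable def Dx (dx : ℝ) (ψ : ℤ × ℤ → ℝ) : ℤ × ℤ → ℝ :=
  fun c => (ψ (c.1 + 1, c.2) + ψ (c.1 + 1, c.2 + 1) - ψ (c.1, c.2) - ψ (c.1, c.2 + 1)) / (2 * dx)

/-- Vertex-to-cell gradient in the y-direction on the staggered grid. -/
noncomputable def Dy (dy : ℝ) (ψ : ℤ × ℤ → ℝ) : ℤ × ℤ → ℝ :=
  fun c => (ψ (c.1, c.2 + 1) + ψ (c.1 + 1, c.2 + 1) - ψ (c.1, c.2) - ψ (c.1 + 1, c.2)) / (2 * dy)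

/-- The x-gradient of a vertex function `J` with `a J = u - b v`. -/
theorem mul_Dx_of_mul_eq (dx a b : ℝ) {J u v : ℤ × ℤ → ℝ}
    (h : ∀ p, a * J p = u p - b * v p) (c : ℤ × ℤ) :
    a * Dx dx J c = Dx dx u c - b * Dx dx v c := by
  simp only [Dx, mul_div_assoc', ← sub_div, mul_add, mul_sub, h]
  ring

/-- The y-gradient of a vertex function `J` with `a J = u - b v`. -/
theorem mul_Dy_of_mul_eq (dy a b : ℝ) {J u v : ℤ × ℤ → ℝ}
    (h : ∀ p, a * J p = u p - b * v p) (c : ℤ × ℤ) :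
    a * Dy dy J c = Dy dy u c - b * Dy dy v c := by
  simp only [Dy, mul_div_assoc', ← sub_div, mul_add, mul_sub, h]
  ring

/-- Equivalence of the coupled discrete temperature subsystem (implicit update of the
thermal impulse and temperature) with the scalar discrete temperature wave equation
together with the explicit back-substitution formula for the thermal impulse. -/
theorem temperature_subsystem_equiv_wave (dx dy : ℝ) (hdx : 0 < dx) (hdy : 0 < dy)
    (Δt τ : ℝ) (hΔt : 0 < Δt) (hτ : 0 < τ)
    (d Tstar T : ℤ × ℤ → ℝ) (Jxstar Jystar Jx Jy : ℤ × ℤ → ℝ) :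
    ((∀ p : ℤ × ℤ, Jx p = Jxstar p - Δt * Gx dx T p - (Δt / τ) * Jx p) ∧
     (∀ p : ℤ × ℤ, Jy p = Jystar p - Δt * Gy dy T p - (Δt / τ) * Jy p) ∧
     (∀ c : ℤ × ℤ, d c * T c = d c * Tstar c - Δt * (Dx dx Jx c + Dy dy Jy c)))
    ↔
    ((∀ c : ℤ × ℤ,
        (1 + Δt / τ) * (d c * T c) - Δt ^ 2 * (Dx dx (Gx dx T) c + Dy dy (Gy dy T) c) =
        (1 + Δt / τ) * (d c * Tstar c) - Δt * (Dx dx Jxstar c + Dy dy Jystar c)) ∧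
     (∀ p : ℤ × ℤ, Jx p = (τ / (τ + Δt)) * (Jxstar p - Δt * Gx dx T p)) ∧
     (∀ p : ℤ × ℤ, Jy p = (τ / (τ + Δt)) * (Jystar p - Δt * Gy dy T p))) := by
  have ha : 1 + Δt / τ ≠ 0 := by positivity
  have hfactor : τ / (τ + Δt) = (1 + Δt / τ)⁻¹ := by field_simp
  have himplicit (j w : ℝ) : j = w - Δt / τ * j ↔ (1 + Δt / τ) * j = w := by
    constructor <;> intro h <;> linarith
  have hexplicit (j w : ℝ) : j = τ / (τ + Δt) * w ↔ (1 + Δt / τ) * j = w := by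
    rw [hfactor, eq_inv_mul_iff_mul_eq₀ ha]
  simp only [himplicit, hexplicit]
  rw [← and_assoc, and_comm]
  refine and_congr_left fun ⟨hx, hy⟩ => forall_congr' fun c => ?_
  have hDx := mul_Dx_of_mul_eq dx _ _ hx c
  have hDy := mul_Dy_of_mul_eq dy _ _ hy c
  rw [← mul_right_inj' ha]
  constructor <;> intro h
  · linear_combination h - Δt * (hDx + hDy)
  · linear_combination h + Δt * (hDx + hDy)
end

section
/- Equivalence of the coupled discrete pressure subsystem with the scalar pressure wave equation: let Δt > 0, γ > 1, let h : ℤ × ℤ → ℝ be a vertex function, p*, p : ℤ × ℤ → ℝ cell functions, and m*_x, m*_y, m_x, m_y : ℤ × ℤ → ℝ vertex functions. Then the following two systems are equivalent: (A) for all vertices q and k ∈ {x,y}, m_k(q) = m*_k(q) − Δt·(G_k p)(q), and for all cells c, p(c)/(γ−1) = p*(c)/(γ−1) − Δt·((D_x(h·m_x))(c) + (D_y(h·m_y))(c)); (B) for all cells c, p(c)/(γ−1) − Δt²·((D_x(h·G_x p))(c) + (D_y(h·G_y p))(c)) = p*(c)/(γ−1) − Δt·((D_x(h·m*_x))(c)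 + (D_y(h·m*_y))(c)), and for all vertices q and k ∈ {x,y}, m_k(q) = m*_k(q) − Δt·(G_k p)(q). Here h·ψ denotes the pointwise product of vertex functions. -/
/-- Equivalence of the coupled discrete pressure subsystem (implicit update of the
momentum and pressure) with the scalar discrete pressure wave equation together with
the explicit momentum update formula. Here h·ψ denotes the pointwise product. -/
theorem pressure_subsystem_equiv_wave (dx dy : ℝ) (hdx : 0 < dx) (hdy : 0 < dy)
    (Δt γ : ℝ) (hΔt : 0 < Δt) (hγ : 1 < γ)
    (h : ℤ × ℤ → ℝ) (pstar p : ℤ × ℤ → ℝ) (mxstar mystar mx my : ℤ × ℤ → ℝ) :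
    ((∀ q : ℤ × ℤ, mx q = mxstar q - Δt * Gx dx p q) ∧
     (∀ q : ℤ × ℤ, my q = mystar q - Δt * Gy dy p q) ∧
     (∀ c : ℤ × ℤ, p c / (γ - 1) = pstar c / (γ - 1) -
        Δt * (Dx dx (fun q => h q * mx q) c + Dy dy (fun q => h q * my q) c)))
    ↔
    ((∀ c : ℤ × ℤ,
        p c / (γ - 1) - Δt ^ 2 * (Dx dx (fun q => h q * Gx dx p q) c +
          Dy dy (fun q => h q * Gy dy p q) c) =
        pstar c / (γ - 1) -
          Δt * (Dx dx (fun q => h q * mxstar q) c + Dy dy (fun q => h q * mystar q) c)) ∧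
     (∀ q : ℤ × ℤ, mx q = mxstar q - Δt * Gx dx p q) ∧
     (∀ q : ℤ × ℤ, my q = mystar q - Δt * Gy dy p q)) := by
  have hDx (f g : ℤ × ℤ → ℝ) (c : ℤ × ℤ) : Dx dx (fun q => h q * (f q - Δt * g q)) c =
      Dx dx (fun q => h q * f q) c - Δt * Dx dx (fun q => h q * g q) c := by
    simp only [Dx]
    ring
  have hDy (f g : ℤ × ℤ → ℝ) (c : ℤ × ℤ) : Dy dy (fun q => h q * (f q - Δt * g q)) c =
      Dy dy (fun q => h q * f q) c - Δt * Dy dy (fun q => h q * g q) c := by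
    simp only [Dy]
    ring
  constructor
  · rintro ⟨hmx, hmy, hp⟩
    refine ⟨fun c => ?_, hmx, hmy⟩
    have hpc := hp c
    simp only [hmx, hmy, hDx, hDy] at hpc
    linear_combination hpc
  · rintro ⟨hp, hmx, hmy⟩
    refine ⟨hmx, hmy, fun c => ?_⟩
    simp only [hmx, hmy, hDx, hDy]
    linear_combination hp c
end

section
/- Structure preservation of the compatible update: discrete curl-free cell vector fields remain discretely curl-free. Let Δt ∈ ℝ, let v₁, v₂ : ℤ × ℤ → ℝ be vertex functions (velocity components) and A₁, A₂ : ℤ × ℤ → ℝ cell functions (the two components of a row of the distortion field, or of the thermal impulse). Define the vertex averages Ā_m(i,j) = (A_m(i,j) + A_m(i−1,j) + A_m(i,j−1) + A_m(i−1,j−1))/4, the vertex function f = v₁·Ā₁ + v₂·Ā₂, and for k ∈ {1,2} the updated cell fields A_k^{new}(i,j) = A_k(i,j) − Δt·(D_k f)(i,j) − (Δt/4)·∑_{q ∈ P(i,j)} [v₁(q)·((G₁ A_k)(q) − (G_k A₁)(q)) + v₂(q)·((G₂ A_k)(q) − (G_k A₂)(q))], where P(i,j) = {(i,j), (i+1,j),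 (i,j+1), (i+1,j+1)} is the set of the four vertices of cell (i,j), and G₁ = G_x, G₂ = G_y, D₁ = D_x, D₂ = D_y. If the field (A₁, A₂) is discretely curl-free, i.e. (G_x A₂)(q) = (G_y A₁)(q) for every vertex q, then the updated field is discretely curl-free as well: (G_x A₂^{new})(q) = (G_y A₁^{new})(q) for every vertex q. -/
/-- Vertex average of a cell function: the arithmetic mean of the four cells
surrounding a vertex. -/
noncomputable def vavg (A : ℤ × ℤ → ℝ) : ℤ × ℤ → ℝ :=
  fun q => (A (q.1, q.2) + A (q.1 - 1, q.2) + A (q.1, q.2 - 1) + A (q.1 - 1, q.2 - 1)) / 4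

/-- The nonconservative (curl) vertex term of the compatible update for the
first component: v₁·(G₁A₁ − G₁A₁) + v₂·(G₂A₁ − G₁A₂). -/
noncomputable def curlTerm1 (dx dy : ℝ) (v₁ v₂ A₁ A₂ : ℤ × ℤ → ℝ) : ℤ × ℤ → ℝ :=
  fun q => v₁ q * (Gx dx A₁ q - Gx dx A₁ q) + v₂ q * (Gy dy A₁ q - Gx dx A₂ q)

/-- The nonconservative (curl) vertex term of the compatible update for the
second component: v₁·(G₁A₂ − G₂A₁) + v₂·(G₂A₂ − G₂A₂). -/
noncomputable def curlTerm2 (dx dy : ℝ) (v₁ v₂ A₁ A₂ : ℤ × ℤ → ℝ) : ℤ × ℤ → ℝ :=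
  fun q => v₁ q * (Gx dx A₂ q - Gy dy A₁ q) + v₂ q * (Gy dy A₂ q - Gy dy A₂ q)

/-- Sum of a vertex function over the four vertices of cell (i,j). -/
noncomputable def vertexSum (s : ℤ × ℤ → ℝ) : ℤ × ℤ → ℝ :=
  fun c => s (c.1, c.2) + s (c.1 + 1, c.2) + s (c.1, c.2 + 1) + s (c.1 + 1, c.2 + 1)

/-- Compatible update of the first component of a cell vector field. -/
noncomputable def Anew1 (dx dy Δt : ℝ) (v₁ v₂ A₁ A₂ : ℤ × ℤ → ℝ) : ℤ × ℤ → ℝ :=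
  fun c => A₁ c
    - Δt * Dx dx (fun q => v₁ q * vavg A₁ q + v₂ q * vavg A₂ q) c
    - (Δt / 4) * vertexSum (curlTerm1 dx dy v₁ v₂ A₁ A₂) c

/-- Compatible update of the second component of a cell vector field. -/
noncomputable def Anew2 (dx dy Δt : ℝ) (v₁ v₂ A₁ A₂ : ℤ × ℤ → ℝ) : ℤ × ℤ → ℝ :=
  fun c => A₂ c
    - Δt * Dy dy (fun q => v₁ q * vavg A₁ q + v₂ q * vavg A₂ q) c
    - (Δt / 4) * vertexSum (curlTerm2 dx dy v₁ v₂ A₁ A₂) c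

theorem Gx_Dy_comm (dx dy : ℝ) (f : ℤ × ℤ → ℝ) (q : ℤ × ℤ) :
    Gx dx (Dy dy f) q = Gy dy (Dx dx f) q := by
  simp only [Gx, Gy, Dx, Dy, sub_add_cancel]
  ring

theorem Gx_sub_const_mul (dx c : ℝ) (φ χ : ℤ × ℤ → ℝ) (q : ℤ × ℤ) :
    Gx dx (fun p => φ p - c * χ p) q = Gx dx φ q - c * Gx dx χ q := by
  simp only [Gx]
  ring

theorem Gy_sub_const_mul (dy c : ℝ) (φ χ : ℤ × ℤ → ℝ) (q : ℤ × ℤ) :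
    Gy dy (fun p => φ p - c * χ p) q = Gy dy φ q - c * Gy dy χ q := by
  simp only [Gy]
  ring

/-- Structure preservation of the compatible update: if the cell vector field
(A₁, A₂) is discretely curl-free, then so is its compatible update. -/
theorem compatible_update_preserves_curl_free (dx dy : ℝ) (hdx : 0 < dx) (hdy : 0 < dy)
    (Δt : ℝ) (v₁ v₂ : ℤ × ℤ → ℝ) (A₁ A₂ : ℤ × ℤ → ℝ)
    (hcurl : ∀ q : ℤ × ℤ, Gx dx A₂ q = Gy dy A₁ q) :
    ∀ q : ℤ × ℤ,
      Gx dx (Anew2 dx dy Δt v₁ v₂ A₁ A₂) q = Gy dy (Anew1 dx dy Δt v₁ v₂ A₁ A₂) q := by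
  have h₁ : Anew1 dx dy Δt v₁ v₂ A₁ A₂ = fun c => A₁ c
      - Δt * Dx dx (fun q => v₁ q * vavg A₁ q + v₂ q * vavg A₂ q) c := by
    funext c
    simp [Anew1, vertexSum, curlTerm1, hcurl]
  have h₂ : Anew2 dx dy Δt v₁ v₂ A₁ A₂ = fun c => A₂ c
      - Δt * Dy dy (fun q => v₁ q * vavg A₁ q + v₂ q * vavg A₂ q) c := by
    funext c
    simp [Anew2, vertexSum, curlTerm2, hcurl]
  intro q
  rw [h₁, h₂, Gx_sub_const_mul, Gy_sub_const_mul, hcurl, Gx_Dy_comm]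
end
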